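/- Let n ≥ 3 and let P ⊆ ℝⁿ be a lattice n-polytope such that the topological interior of the dilate (n−1)P contains exactly one point of ℤⁿ. Then P is Gorenstein, i.e. it is Gorenstein at every vertex. (This is the lattice-polytope form of the statement that a projective toric n-fold carrying an ample line bundle L with dim Γ(X, L^{⊗(n−1)} ⊗ ω_X) = 1 is a Gorenstein toric Del Pezzo variety.) -/

import Mathlib

open Set Pointwise

noncomputable section

/-- The set of lattice points of `ℝⁿ`: points with all coordinates integers. -/
def lat (n : ℕ) : Set (Fin n → ℝ) := {x | ∀ i, ∃ z : ℤ, x i = (z : ℝ)}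

/-- The dilate `kP` of a subset `P ⊆ ℝⁿ`. -/
def dilate (n k : ℕ) (P : Set (Fin n → ℝ)) : Set (Fin n → ℝ) :=
  (fun x => (k : ℝ) • x) '' P

/-- A lattice `n`-polytope: the convex hull of finitely many lattice points,
whose affine hull is all of `ℝⁿ`. -/
def IsLatticePolytope (n : ℕ) (P : Set (Fin n → ℝ)) : Prop :=
  (∃ S : Finset (Fin n → ℤ), S.Nonempty ∧
    P = convexHull ℝ ((fun m : Fin n → ℤ => fun i => (m i : ℝ)) '' (S : Set (Fin n → ℤ)))) ∧
  affineSpan ℝ P = ⊤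

/-- The cone of `P` at a point `v`: `C_v(P) = {r • (x - v) : r ≥ 0, x ∈ P}`. -/
def coneAt (n : ℕ) (P : Set (Fin n → ℝ)) (v : Fin n → ℝ) : Set (Fin n → ℝ) :=
  {y | ∃ r : ℝ, 0 ≤ r ∧ ∃ x ∈ P, y = r • (x - v)}

/-- `P` is Gorenstein at `v`: there is a lattice point `m₀` in `C_v(P)` with
`Int(C_v(P)) ∩ ℤⁿ = m₀ + (C_v(P) ∩ ℤⁿ)`. -/
def GorensteinAt (n : ℕ) (P : Set (Fin n → ℝ)) (v : Fin n → ℝ) : Prop :=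
  ∃ m₀ ∈ coneAt n P v ∩ lat n,
    interior (coneAt n P v) ∩ lat n = (fun y => m₀ + y) '' (coneAt n P v ∩ lat n)

/-- `P` is Gorenstein: it is Gorenstein at every vertex (extreme point). -/
def Gorenstein (n : ℕ) (P : Set (Fin n → ℝ)) : Prop :=
  ∀ v ∈ Set.extremePoints ℝ P, GorensteinAt n P v

/-- `F` is a facet of the `n`-polytope `P`: a face (extreme subset) of dimension `n-1`. -/
def IsFacet (n : ℕ) (P F : Set (Fin n → ℝ)) : Prop :=
  IsExtreme ℝ P F ∧ Module.finrank ℝ (affineSpan ℝ F).direction = n - 1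

/-- `P` is a pyramid: there are a facet `F` and a vertex `v ∉ F` with `P = Conv(F ∪ {v})`. -/
def IsPyramid (n : ℕ) (P : Set (Fin n → ℝ)) : Prop :=
  ∃ F v, IsFacet n P F ∧ v ∈ Set.extremePoints ℝ P ∧ v ∉ F ∧
    P = convexHull ℝ (F ∪ {v})

/-- The simplex `D_n = Conv{0, e₁, e₂, e₁+e₂+2e₃, e₄, …, eₙ}` (standard basis `e₁, …, eₙ`,
so `eᵢ = Pi.single i⁻¹` with 0-based indices; the points `Pi.single i 1` for `(i : ℕ) ≠ 2`
are `e₁, e₂, e₄, …, eₙ`, and the last listed point is `e₁ + e₂ + 2e₃`). -/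
def Dn (n : ℕ) : Set (Fin n → ℝ) :=
  convexHull ℝ ({0} ∪ {x | ∃ i : Fin n, (i : ℕ) ≠ 2 ∧ x = Pi.single i (1 : ℝ)} ∪
    {fun j : Fin n => if (j : ℕ) = 0 ∨ (j : ℕ) = 1 then (1 : ℝ) else
      if (j : ℕ) = 2 then 2 else 0})

/-- The affine map `x ↦ A·x + b` of `ℝⁿ` given by an integral matrix `A` and `b ∈ ℤⁿ`. -/
def unimodularMap (n : ℕ) (A : Matrix (Fin n) (Fin n) ℤ) (b : Fin n → ℤ) :
    (Fin n → ℝ) → (Fin n → ℝ) :=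
  fun x => (A.map (Int.cast : ℤ → ℝ)).mulVec x + fun i => (b i : ℝ)

/-- The basic simplex `Conv{0, e₁, …, eₙ}`. -/
def basicSimplex (n : ℕ) : Set (Fin n → ℝ) :=
  convexHull ℝ ({0} ∪ Set.range fun i : Fin n => (Pi.single i (1 : ℝ) : Fin n → ℝ))

/-- A ray (one-dimensional face) of a cone `C`. -/
def IsRay (n : ℕ) (C ρ : Set (Fin n → ℝ)) : Prop :=
  IsExtreme ℝ C ρ ∧ Module.finrank ℝ (Submodule.span ℝ ρ) = 1


section HalfOpen

variable {V κ : Type*} [AddCommGroup V] [Module ℝ V]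

/-- The points with nonnegative coordinates in the basis `b`, the coordinates in `s` being
positive. -/
def halfOpenCone (b : Module.Basis κ ℝ V) (s : κ → Prop) : Set V :=
  {x | ∀ i, 0 ≤ b.repr x i ∧ (s i → 0 < b.repr x i)}

/-- The fundamental box of the half-open cone: coordinates lie in `(0, 1]` on `s` and in `[0, 1)`
off `s`. -/
def halfOpenBox (b : Module.Basis κ ℝ V) (s : κ → Prop) : Set V :=
  {x | ∀ i, (s i → 0 < b.repr x i ∧ b.repr x i ≤ 1) ∧ (¬ s i → 0 ≤ b.repr x i ∧ b.repr x i < 1)}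

lemma halfOpenBox_subset_halfOpenCone {b : Module.Basis κ ℝ V} {s : κ → Prop} :
    halfOpenBox b s ⊆ halfOpenCone b s := by
  intro x hx i
  by_cases hs : s i
  · exact ⟨((hx i).1 hs).1.le, fun _ => ((hx i).1 hs).1⟩
  · exact ⟨((hx i).2 hs).1, fun h => absurd h hs⟩

/-- The number of lattice points of height `k` in a subset of `V`. -/
def latticeCount (Λ : AddSubgroup V) (h : V →ₗ[ℝ] ℝ) (A : Set V) (k : ℕ) : ℕ :=
  Nat.card {x : V // x ∈ Λ ∧ x ∈ A ∧ h x = k}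

/-- The number of `N`-tuples of natural numbers with sum `k - j`. -/
def compCount (N j k : ℕ) : ℕ :=
  Nat.card {a : Fin N → ℕ // ∑ i, a i + j = k}

lemma compCount_add_add (N c j k : ℕ) : compCount N (c + j) (k + c) = compCount N j k := by
  unfold compCount
  refine Nat.card_congr (Equiv.subtypeEquivRight fun a => ?_)
  omega

lemma compCount_self (N j : ℕ) : compCount N j j = 1 := by
  unfold compCount
  rw [Nat.card_eq_one_iff_unique]
  refine ⟨⟨fun a c => ?_⟩, ⟨⟨0, by simp⟩⟩⟩
  have ha := a.2
  have hc := c.2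
  simp only [Nat.add_eq_right, Finset.sum_eq_zero_iff, Finset.mem_univ, true_implies] at ha hc
  ext i
  rw [ha, hc]

lemma compCount_of_lt {N j k : ℕ} (hjk : k < j) : compCount N j k = 0 := by
  unfold compCount
  have : IsEmpty {a : Fin N → ℕ // ∑ i, a i + j = k} := ⟨fun a => by have := a.2; omega⟩
  exact Nat.card_of_isEmpty

lemma card_tuples_eq_compCount [Fintype κ] (j k : ℕ) :
    Nat.card {a : κ → ℕ // ∑ i, a i + j = k} = compCount (Fintype.card κ) j k := by
  unfold compCount
  refine Nat.card_congr (Equiv.subtypeEquiv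
    (Equiv.arrowCongr (Fintype.equivFin κ) (Equiv.refl ℕ)) fun a => ?_)
  have : ∑ i, a ((Fintype.equivFin κ).symm i) = ∑ i, a i := Equiv.sum_comp _ a
  simp [Equiv.arrowCongr, this]

lemma finite_tuples [Fintype κ] (j k : ℕ) : Finite {a : κ → ℕ // ∑ i, a i + j = k} := by
  classical
  refine Set.Finite.subset (Finset.finite_toSet (Fintype.piFinset fun _ : κ => Finset.range (k + 1)))
    fun a ha => ?_
  simp only [Finset.mem_coe, Fintype.mem_piFinset, Finset.mem_range]
  intro i
  have h1 := Finset.single_le_sum (fun i _ => Nat.zero_le (a i)) (Finset.mem_univ i)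
  have h2 : ∑ i, a i + j = k := ha
  omega

variable [Fintype κ] {Λ : AddSubgroup V} {h : V →ₗ[ℝ] ℝ} {b : Module.Basis κ ℝ V} {s : κ → Prop}

lemma map_eq_sum_repr (hb : ∀ i, h (b i) = 1) (x : V) : h x = ∑ i, b.repr x i := by
  conv_lhs => rw [← b.sum_repr x, map_sum]
  simp only [map_smul, hb, smul_eq_mul, mul_one]

lemma repr_add_sum_nsmul (g : V) (a : κ → ℕ) (i : κ) :
    b.repr (g + ∑ i, a i • b i) i = b.repr g i + a i := by
  classical
  simp only [map_add, map_sum, Finsupp.add_apply, Finsupp.finsetSum_apply, map_nsmul,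
    Finsupp.smul_apply, b.repr_self, add_right_inj]
  rw [Finset.sum_eq_single i]
  · simp
  · intro j _ hj
    simp [Finsupp.single_eq_of_ne hj.symm]
  · simp

/-- Lattice points of a half-open simplicial cone are counted by the lattice points of its
fundamental box. -/
theorem latticeCount_halfOpenCone (hbΛ : ∀ i, b i ∈ Λ) (hb : ∀ i, h (b i) = 1)
    (hΛ : ∀ x ∈ Λ, ∃ z : ℤ, h x = z)
    (hfin : ∀ k : ℕ, {x : V | x ∈ Λ ∧ (∀ i, 0 ≤ b.repr x i) ∧ h x = k}.Finite) (k : ℕ) :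
    latticeCount Λ h (halfOpenCone b s) k =
      ∑ j : Fin (Fintype.card κ + 1), latticeCount Λ h (halfOpenBox b s) j *
        compCount (Fintype.card κ) j k := by
  classical
  have hfinBox : ∀ j : ℕ, Finite {x : V // x ∈ Λ ∧ x ∈ halfOpenBox b s ∧ h x = j} := fun j =>
    Set.Finite.subset (hfin j) fun x hx =>
      ⟨hx.1, fun i => (halfOpenBox_subset_halfOpenCone hx.2.1 i).1, hx.2.2⟩
  have hfinT := fun j => finite_tuples (κ := κ) j k
  let X := Σ j : Fin (Fintype.card κ + 1),
    {x : V // x ∈ Λ ∧ x ∈ halfOpenBox b s ∧ h x = (j : ℕ)} × {a : κ → ℕ // ∑ i, a i + j = k}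
  let f : X → {x : V // x ∈ Λ ∧ x ∈ halfOpenCone b s ∧ h x = k} := fun p =>
    ⟨p.2.1.1 + ∑ i, p.2.2.1 i • b i, by
      obtain ⟨j, ⟨g, hgΛ, hg, hgh⟩, ⟨a, ha⟩⟩ := p
      refine ⟨Λ.add_mem hgΛ (sum_mem fun i _ => Λ.nsmul_mem (hbΛ i) _), fun i => ?_, ?_⟩
      · have := halfOpenBox_subset_halfOpenCone hg i
        simp only [repr_add_sum_nsmul]
        have h0 : (0 : ℝ) ≤ a i := Nat.cast_nonneg _
        exact ⟨by linarith [this.1], fun hs => by linarith [this.2 hs]⟩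
      · simp only [map_add, map_sum, map_nsmul, hb, hgh]
        rw [← ha]
        simp [add_comm]⟩
  have hf : Function.Bijective f := by
    constructor
    · rintro ⟨j, ⟨g, hgΛ, hg, hgh⟩, ⟨a, ha⟩⟩ ⟨j', ⟨g', hgΛ', hg', hgh'⟩, ⟨a', ha'⟩⟩ hEq
      have hEq' : g + ∑ i, a i • b i = g' + ∑ i, a' i • b i := congrArg Subtype.val hEq
      have haa : a = a' := by
        funext i
        have h1 := congrArg (fun x => b.repr x i) hEq'
        simp only [repr_add_sum_nsmul] at h1
        have hd : ((a i : ℤ) : ℝ) - (a' i : ℤ) = b.repr g' i - b.repr g i := by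
          push_cast; linarith
        have h2 : ((a i - a' i : ℤ) : ℝ) < 1 ∧ (-1 : ℝ) < ((a i - a' i : ℤ) : ℝ) := by
          rw [Int.cast_sub, hd]
          by_cases hs : s i
          · have := (hg i).1 hs
            have := (hg' i).1 hs
            constructor <;> linarith
          · have := (hg i).2 hs
            have := (hg' i).2 hs
            constructor <;> linarith
        have h3 : (a i - a' i : ℤ) < 1 := by exact_mod_cast h2.1
        have h4 : -1 < (a i - a' i : ℤ) := by exact_mod_cast h2.2
        omega
      subst haa
      have hgg : g = g' := add_right_cancel hEq'
      subst hgg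
      have hjj : j = j' := by
        ext
        exact_mod_cast hgh.symm.trans hgh'
      subst hjj
      rfl
    · rintro ⟨x, hxΛ, hx, hxh⟩
      have hex : ∀ i, ∃ m : ℕ, (s i → 0 < b.repr x i - m ∧ b.repr x i - m ≤ 1) ∧
          (¬ s i → 0 ≤ b.repr x i - m ∧ b.repr x i - m < 1) := by
        intro i
        by_cases hs : s i
        · have h0 := (hx i).2 hs
          have h1 : 1 ≤ ⌈b.repr x i⌉₊ := Nat.one_le_ceil_iff.mpr h0
          refine ⟨⌈b.repr x i⌉₊ - 1, fun _ => ?_, fun h => absurd hs h⟩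
          have h2 := Nat.le_ceil (b.repr x i)
          have h3 := Nat.ceil_lt_add_one h0.le
          push_cast [h1]
          constructor <;> linarith
        · have h0 := (hx i).1
          refine ⟨⌊b.repr x i⌋₊, fun h => absurd h hs, fun _ => ?_⟩
          have h2 := Nat.floor_le h0
          have h3 := Nat.lt_floor_add_one (b.repr x i)
          constructor <;> linarith
      choose a ha using hex
      set g := x - ∑ i, a i • b i with hgdef
      have hxg : x = g + ∑ i, a i • b i := by simp [hgdef]
      have hgr : ∀ i, b.repr g i = b.repr x i - a i := by
        intro i
        have := repr_add_sum_nsmul (b := b) g a i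
        rw [← hxg] at this
        linarith
      have hgΛ : g ∈ Λ := Λ.sub_mem hxΛ (sum_mem fun i _ => Λ.nsmul_mem (hbΛ i) _)
      have hgbox : g ∈ halfOpenBox b s := fun i => by
        rw [hgr]
        exact ha i
      obtain ⟨z, hz⟩ := hΛ g hgΛ
      have hz0 : 0 ≤ z := by
        have : (0 : ℝ) ≤ z := by
          rw [← hz, map_eq_sum_repr hb]
          exact Finset.sum_nonneg fun i _ => (halfOpenBox_subset_halfOpenCone hgbox i).1
        exact_mod_cast this
      have hzN : z ≤ Fintype.card κ := by
        have : (z : ℝ) ≤ Fintype.card κ := by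
          rw [← hz, map_eq_sum_repr hb]
          have : ∑ i, b.repr g i ≤ ∑ _i : κ, (1 : ℝ) := Finset.sum_le_sum fun i _ => by
            by_cases hs : s i
            · exact ((hgbox i).1 hs).2
            · exact ((hgbox i).2 hs).2.le
          simpa using this
        exact_mod_cast this
      obtain ⟨j, rfl⟩ := Int.eq_ofNat_of_zero_le hz0
      have hsum : ∑ i, a i + j = k := by
        have h1 : h x = j + ∑ i, (a i : ℝ) := by
          rw [hxg]
          simp [hb, hz]
        rw [hxh] at h1
        have h2 : (k : ℝ) = ((j + ∑ i, a i : ℕ) : ℝ) := by rw [h1]; push_cast; rfl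
        have h3 : k = j + ∑ i, a i := by exact_mod_cast h2
        omega
      refine ⟨⟨⟨j, by omega⟩, ⟨g, hgΛ, hgbox, by simpa using hz⟩, ⟨a, hsum⟩⟩, ?_⟩
      exact Subtype.ext hxg.symm
  unfold latticeCount
  rw [← Nat.card_congr (Equiv.ofBijective f hf), Nat.card_sigma]
  refine Finset.sum_congr rfl fun j _ => ?_
  rw [Nat.card_prod, card_tuples_eq_compCount]

/-- The reflection `g ↦ ∑ i, b i - g` exchanges the two complementary half-open boxes. -/
theorem latticeCount_halfOpenBox_compl (hbΛ : ∀ i, b i ∈ Λ) (hb : ∀ i, h (b i) = 1) {j j' : ℕ}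
    (hj : j + j' = Fintype.card κ) :
    latticeCount Λ h (halfOpenBox b s) j =
      latticeCount Λ h (halfOpenBox b fun i => ¬ s i) j' := by
  have hr : ∀ g i, b.repr (∑ i, b i - g) i = 1 - b.repr g i := by
    intro g i
    have := repr_add_sum_nsmul (b := b) (-g) (fun _ => 1) i
    simp only [one_smul, Nat.cast_one] at this
    rw [show ∑ i, b i - g = -g + ∑ i, b i by abel, this]
    simp only [map_neg, Finsupp.coe_neg, Pi.neg_apply]
    ring
  have hjR : (j : ℝ) + j' = Fintype.card κ := by exact_mod_cast hj
  have hsum : ∑ i, b i ∈ Λ := sum_mem fun i _ => hbΛ i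
  refine Nat.card_congr (Equiv.subtypeEquiv (Equiv.subLeft (∑ i, b i)) fun g => ?_)
  simp only [Equiv.subLeft_apply]
  refine and_congr ⟨fun h => Λ.sub_mem hsum h, fun h => ?_⟩ (and_congr ?_ ?_)
  · simpa using Λ.sub_mem hsum h
  · refine forall_congr' fun i => ?_
    rw [hr]
    by_cases hs : s i
    · simp [hs, and_comm]
    · simp [hs, and_comm]
  · rw [map_sub, map_sum]
    simp only [hb, Finset.sum_const, Finset.card_univ, nsmul_eq_mul, mul_one]
    constructor <;> intro h <;> linarith

end HalfOpen

section Triangulation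

variable {V ι : Type*} [AddCommGroup V] [Module ℝ V]

/-- The sets of indices of bases contained in a family of vectors. -/
abbrev BasisIndex (v : ι → V) : Type _ :=
  {t : Finset ι // t.card = Module.finrank ℝ V ∧ ⊤ ≤ Submodule.span ℝ (v '' t)}

variable {v : ι → V}

/-- The basis given by a set of indices. -/
def indexBasis (t : BasisIndex v) : Module.Basis t.1 ℝ V :=
  basisOfTopLeSpanOfCardEqFinrank (fun i : t.1 => v i)
    (by
      have h : Set.range (fun i : t.1 => v i) = v '' t.1 := by
        rw [Set.image_eq_range]
        rfl
      rw [h]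
      exact t.2.2)
    (by rw [Fintype.card_coe]; exact t.2.1)

@[simp]
lemma indexBasis_apply (t : BasisIndex v) (i : t.1) : indexBasis t i = v i := by
  simp [indexBasis]

/-- The linear functional with values `ω i` on the vectors of a basis. -/
def price (ω : ι → ℝ) (t : BasisIndex v) : V →ₗ[ℝ] ℝ :=
  (indexBasis t).constr ℝ fun i => ω i

lemma price_of_mem (ω : ι → ℝ) (t : BasisIndex v) {i : ι} (hi : i ∈ t.1) :
    price ω t (v i) = ω i := by
  have := (indexBasis t).constr_basis ℝ (fun i => ω i) ⟨i, hi⟩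
  simpa [price] using this

/-- The bases that form the regular triangulation given by the prices `ω`. -/
def IsRegularBasis (ω : ι → ℝ) (t : BasisIndex v) : Prop :=
  ∀ j ∉ t.1, price ω t (v j) < ω j

lemma IsRegularBasis.price_le {ω : ι → ℝ} {t : BasisIndex v} (ht : IsRegularBasis ω t) (j : ι) :
    price ω t (v j) ≤ ω j := by
  by_cases hj : j ∈ t.1
  · exact (price_of_mem ω t hj).le
  · exact (ht j hj).le

variable [Fintype ι]

/-- The convex cone generated by a finite family of vectors. -/
def coneOf (v : ι → V) : Set V :=
  {x | ∃ a : ι → ℝ, (∀ i, 0 ≤ a i) ∧ ∑ i, a i • v i = x}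

lemma sum_eq_sum_coe (t : Finset ι) {M : Type*} [AddCommMonoid M] {f : ι → M}
    (hf : ∀ i ∉ t, f i = 0) : ∑ i, f i = ∑ i : t, f i := by
  rw [Finset.sum_coe_sort t f]
  exact (Finset.sum_subset (Finset.subset_univ t) fun i _ hi => hf i hi).symm

lemma sum_smul_eq_sum_indexBasis (t : BasisIndex v) {a : ι → ℝ} (ha : ∀ i ∉ t.1, a i = 0) :
    ∑ i, a i • v i = ∑ i : t.1, a i • indexBasis t i := by
  rw [sum_eq_sum_coe t.1 fun i hi => by rw [ha i hi, zero_smul]]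
  simp

lemma repr_indexBasis_of_sum (t : BasisIndex v) {a : ι → ℝ} (ha : ∀ i ∉ t.1, a i = 0) {x : V}
    (hx : ∑ i, a i • v i = x) (i : t.1) : (indexBasis t).repr x i = a i := by
  rw [← hx, sum_smul_eq_sum_indexBasis t ha, (indexBasis t).repr_sum_self]

lemma exists_coeff (t : BasisIndex v) (x : V) :
    ∃ a : ι → ℝ, (∀ i ∉ t.1, a i = 0) ∧ ∑ i, a i • v i = x := by
  classical
  have h0 : ∀ i ∉ t.1, (fun i => if h : i ∈ t.1 then (indexBasis t).repr x ⟨i, h⟩ else 0) i = 0 :=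
    fun i hi => by simp [hi]
  refine ⟨_, h0, ?_⟩
  rw [sum_smul_eq_sum_indexBasis t h0]
  refine Eq.trans (Finset.sum_congr rfl fun i _ => ?_) ((indexBasis t).sum_repr x)
  simp

lemma mem_coneOf_of_repr_nonneg (t : BasisIndex v) {x : V}
    (hx : ∀ i, 0 ≤ (indexBasis t).repr x i) : x ∈ coneOf v := by
  obtain ⟨a, ha, hax⟩ := exists_coeff t x
  refine ⟨a, fun i => ?_, hax⟩
  by_cases hi : i ∈ t.1
  · rw [← repr_indexBasis_of_sum t ha hax ⟨i, hi⟩]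
    exact hx _
  · rw [ha i hi]

lemma exists_ratio {a c : ι → ℝ} (ha : ∀ i, 0 ≤ a i) (hc : ∃ i, 0 < c i) :
    ∃ τ i₀, 0 ≤ τ ∧ 0 < c i₀ ∧ a i₀ = τ * c i₀ ∧ ∀ i, 0 ≤ a i - τ * c i := by
  classical
  obtain ⟨i₁, hi₁⟩ := hc
  obtain ⟨i₀, hi₀, hmin⟩ := Finset.exists_min_image (Finset.univ.filter fun i => 0 < c i)
    (fun i => a i / c i) ⟨i₁, by simpa using hi₁⟩
  have hc₀ : 0 < c i₀ := by simpa using hi₀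
  have hτ : 0 ≤ a i₀ / c i₀ := div_nonneg (ha _) hc₀.le
  refine ⟨a i₀ / c i₀, i₀, hτ, hc₀, by field_simp, fun i => ?_⟩
  rcases lt_or_ge 0 (c i) with hi | hi
  · have := hmin i (by simpa using hi)
    have h2 : a i₀ / c i₀ * c i ≤ a i / c i * c i := mul_le_mul_of_nonneg_right this hi.le
    rw [div_mul_cancel₀ _ hi.ne'] at h2
    linarith
  · have := mul_nonneg hτ (neg_nonneg.mpr hi)
    linarith [ha i]

/-- **Carathéodory's theorem** for cones. -/
lemma exists_repr_nonneg (hv : ⊤ ≤ Submodule.span ℝ (Set.range v)) {x : V} (hx : x ∈ coneOf v) :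
    ∃ t : BasisIndex v, ∀ i, 0 ≤ (indexBasis t).repr x i := by
  classical
  obtain ⟨a, ⟨ha, hax⟩, hmin⟩ := WellFounded.has_min
    (measure fun a : ι → ℝ => (Finset.univ.filter fun i => a i ≠ 0).card).wf _ hx
  have hmin' : ∀ c : ι → ℝ, (∀ i, a i = 0 → c i = 0) → ∑ i, c i • v i = 0 → ∀ i, c i ≤ 0 := by
    intro c hc hcv
    by_contra! hpos
    obtain ⟨τ, i₀, -, hc₀, hi₀, hnn⟩ := exists_ratio ha hpos
    refine hmin (fun i => a i - τ * c i) ⟨hnn, ?_⟩ ?_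
    · simp only [sub_smul, mul_smul, Finset.sum_sub_distrib, ← Finset.smul_sum, hcv, hax]
      simp
    · refine Finset.card_lt_card (Finset.ssubset_iff_of_subset ?_ |>.mpr ⟨i₀, ?_, ?_⟩)
      · intro i
        simp only [Finset.mem_filter, Finset.mem_univ, true_and]
        intro h1 h2
        exact h1 (by rw [h2, hc i h2]; simp)
      · simp only [Finset.mem_filter, Finset.mem_univ, true_and]
        intro h2
        exact hc₀.ne' (hc _ h2)
      · simp [hi₀]
  have hli : LinearIndepOn ℝ v (Finset.univ.filter fun i => a i ≠ 0 : Finset ι) := by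
    rw [linearIndepOn_finset_iff]
    intro f hf i hi
    set c : ι → ℝ := fun i => if a i = 0 then 0 else f i with hcdef
    have hc : ∀ i, a i = 0 → c i = 0 := fun i hi => by simp [hcdef, hi]
    have hcv : ∑ i, c i • v i = 0 := by
      rw [← hf, Finset.sum_filter]
      refine Finset.sum_congr rfl fun i _ => ?_
      by_cases h : a i = 0 <;> simp [hcdef, h]
    have h1 := hmin' c hc hcv i
    have h2 := hmin' (fun i => - c i) (fun i hi => by simp [hc i hi])
      (by simp [neg_smul, hcv]) i
    have h3 : c i = f i := if_neg (by simpa using hi)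
    rw [← h3]
    linarith
  obtain ⟨B, -, hsB, hspan, hB⟩ := exists_linearIndepOn_extension hli (Set.subset_univ _)
  have hspan' : ⊤ ≤ Submodule.span ℝ (v '' B) := by
    rw [Set.image_univ] at hspan
    exact hv.trans (Submodule.span_le.mpr hspan)
  have hcard : B.toFinset.card = Module.finrank ℝ V := by
    have hspan2 : ⊤ ≤ Submodule.span ℝ (Set.range fun i : B => v i) := by
      rwa [← Set.image_eq_range]
    rw [Module.finrank_eq_card_basis (Module.Basis.mk hB hspan2), Set.toFinset_card]
  refine ⟨⟨B.toFinset, hcard, by simpa using hspan'⟩, fun i => ?_⟩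
  rw [repr_indexBasis_of_sum _ (a := a) (fun i hi => ?_) hax]
  · exact ha _
  · by_contra h
    exact hi (Set.mem_toFinset.mpr (hsB (by simpa using h)))

lemma price_of_sum (ω : ι → ℝ) (t : BasisIndex v) {a : ι → ℝ} (ha : ∀ i ∉ t.1, a i = 0) {x : V}
    (hx : ∑ i, a i • v i = x) : price ω t x = ∑ i, a i * ω i := by
  rw [← hx, map_sum]
  refine Finset.sum_congr rfl fun i _ => ?_
  by_cases hi : i ∈ t.1
  · rw [map_smul, price_of_mem ω t hi, smul_eq_mul]
  · simp [ha i hi]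

/-- The prices are generic if no basis prices another vector exactly. -/
def IsGenericPrice (v : ι → V) (ω : ι → ℝ) : Prop :=
  ∀ t : BasisIndex v, ∀ j ∉ t.1, price ω t (v j) ≠ ω j

lemma exists_isGenericPrice (v : ι → V) : ∃ ω, IsGenericPrice v ω := by
  classical
  let f : (Σ t : BasisIndex v, {j // j ∉ t.1}) → Module.Dual ℝ (ι → ℝ) := fun p =>
    LinearMap.proj p.2.1 -
      ∑ i : p.1.1, (indexBasis p.1).repr (v p.2.1) i • LinearMap.proj (i : ι)
  obtain ⟨ω, hω⟩ := Module.Dual.exists_forall_ne_zero_of_forall_exists f (by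
    rintro ⟨t, j, hj⟩
    refine ⟨Pi.single j 1, ?_⟩
    have : ∀ i : t.1, (Pi.single j (1 : ℝ) : ι → ℝ) i = 0 := fun i =>
      Pi.single_eq_of_ne (fun h : (i : ι) = j => hj (h ▸ i.2)) _
    simp [f, this])
  refine ⟨ω, fun t j hj h => hω ⟨t, j, hj⟩ ?_⟩
  have : price ω t (v j) = ∑ i : t.1, (indexBasis t).repr (v j) i * ω i := by
    simp [price, Module.Basis.constr_apply_fintype]
  simp [f, ← h, this]

lemma IsRegularBasis.subset {ω : ι → ℝ} {t u : BasisIndex v} (ht : IsRegularBasis ω t)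
    (hu : IsRegularBasis ω u) {x : V} (hxt : ∀ i, 0 ≤ (indexBasis t).repr x i)
    (hxu : ∀ i, 0 < (indexBasis u).repr x i) : u.1 ⊆ t.1 := by
  obtain ⟨a, ha, hax⟩ := exists_coeff t x
  obtain ⟨c, hc, hcx⟩ := exists_coeff u x
  have ha0 : ∀ i, 0 ≤ a i := fun i => by
    by_cases hi : i ∈ t.1
    · rw [← repr_indexBasis_of_sum t ha hax ⟨i, hi⟩]; exact hxt _
    · rw [ha i hi]
  have hc0 : ∀ i ∈ u.1, 0 < c i := fun i hi => by
    rw [← repr_indexBasis_of_sum u hc hcx ⟨i, hi⟩]; exact hxu _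
  have h1 : price ω u x ≤ price ω t x := by
    rw [price_of_sum ω t ha hax]
    conv_lhs => rw [← hax, map_sum]
    refine Finset.sum_le_sum fun i _ => ?_
    rw [map_smul, smul_eq_mul]
    exact mul_le_mul_of_nonneg_left (hu.price_le i) (ha0 i)
  intro j hj
  by_contra hjt
  have h2 : price ω t x < price ω u x := by
    rw [price_of_sum ω u hc hcx]
    conv_lhs => rw [← hcx, map_sum]
    refine Finset.sum_lt_sum (fun i _ => ?_) ⟨j, Finset.mem_univ j, ?_⟩
    · rw [map_smul, smul_eq_mul]
      by_cases hi : i ∈ u.1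
      · exact mul_le_mul_of_nonneg_left (ht.price_le i) (hc0 i hi).le
      · simp [hc i hi]
    · rw [map_smul, smul_eq_mul]
      exact mul_lt_mul_of_pos_left (ht j hjt) (hc0 j hj)
  exact absurd h1 (not_le.mpr h2)

/-- The simplex method pivot: a basis whose cone contains `x` and which is not regular can be
exchanged for a cheaper one. -/
lemma exists_price_lt {h : V →ₗ[ℝ] ℝ} (hh : ∀ i, h (v i) = 1) {ω : ι → ℝ}
    {t : BasisIndex v} {x : V} (hx : ∀ i, 0 < (indexBasis t).repr x i) {j : ι} (hj : j ∉ t.1)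
    (hlt : ω j < price ω t (v j)) :
    ∃ u : BasisIndex v, (∀ i, 0 ≤ (indexBasis u).repr x i) ∧ price ω u x < price ω t x := by
  classical
  obtain ⟨a, ha, hax⟩ := exists_coeff t x
  obtain ⟨c, hc, hcv⟩ := exists_coeff t (v j)
  have hapos : ∀ i ∈ t.1, 0 < a i := fun i hi => by
    rw [← repr_indexBasis_of_sum t ha hax ⟨i, hi⟩]; exact hx _
  have ha0 : ∀ i, 0 ≤ a i := fun i => by
    by_cases hi : i ∈ t.1
    · exact (hapos i hi).le
    · rw [ha i hi]
  have hcpos : ∃ i, 0 < c i := by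
    by_contra! hneg
    have h1 : h (v j) = ∑ i, c i := by
      conv_lhs => rw [← hcv, map_sum]
      simp [hh]
    have h2 : ∑ i, c i ≤ 0 := Finset.sum_nonpos fun i _ => hneg i
    rw [← h1, hh] at h2
    linarith
  obtain ⟨τ, i₀, hτ0, hc₀, hi₀, hnn⟩ := exists_ratio ha0 hcpos
  have hi₀t : i₀ ∈ t.1 := by
    by_contra hn
    exact hc₀.ne' (hc _ hn)
  have hτ : 0 < τ := by
    refine hτ0.lt_of_ne fun h0 => ?_
    have := hapos i₀ hi₀t
    rw [hi₀, ← h0] at this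
    simp at this
  have hspan : ⊤ ≤ Submodule.span ℝ (v '' ((insert j (t.1.erase i₀) : Finset ι) : Set ι)) := by
    refine t.2.2.trans (Submodule.span_le.mpr ?_)
    rintro _ ⟨i, hi, rfl⟩
    have hmem : ∀ i ∈ insert j (t.1.erase i₀),
        v i ∈ Submodule.span ℝ (v '' ((insert j (t.1.erase i₀) : Finset ι) : Set ι)) := fun i hi =>
      Submodule.subset_span ⟨i, hi, rfl⟩
    by_cases hii : i = i₀
    · subst hii
      have h1 : c i • v i = v j - ∑ k ∈ Finset.univ.erase i, c k • v k := by
        rw [← hcv, ← Finset.add_sum_erase _ _ (Finset.mem_univ i)]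
        abel
      have h2 : v i = (c i)⁻¹ • (v j - ∑ k ∈ Finset.univ.erase i, c k • v k) := by
        rw [← h1, smul_smul, inv_mul_cancel₀ hc₀.ne', one_smul]
      rw [SetLike.mem_coe, h2]
      refine Submodule.smul_mem _ _ (Submodule.sub_mem _ (hmem j (by simp))
        (Submodule.sum_mem _ fun k hk => ?_))
      by_cases hkt : k ∈ t.1
      · exact Submodule.smul_mem _ _ (hmem k (by simp [hkt, (Finset.mem_erase.mp hk).1]))
      · rw [hc k hkt, zero_smul]
        exact Submodule.zero_mem _
    · exact hmem i (by simp [hii, Finset.mem_coe.mp hi])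
  have hcard : (insert j (t.1.erase i₀)).card = Module.finrank ℝ V := by
    rw [Finset.card_insert_of_notMem (by simp [hj]), Finset.card_erase_of_mem hi₀t, t.2.1]
    have : 0 < t.1.card := Finset.card_pos.mpr ⟨_, hi₀t⟩
    rw [t.2.1] at this
    omega
  let u : BasisIndex v := ⟨insert j (t.1.erase i₀), hcard, hspan⟩
  let a' : ι → ℝ := fun i => a i - τ * c i + Pi.single (M := fun _ => ℝ) j τ i
  have ha' : ∀ i ∉ u.1, a' i = 0 := by
    intro i hi
    simp only [u, Finset.mem_insert, Finset.mem_erase, not_or, not_and'] at hi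
    simp only [a', Pi.single_eq_of_ne hi.1, add_zero]
    by_cases hit : i ∈ t.1
    · have := not_ne_iff.mp (hi.2 hit)
      rw [this, hi₀, sub_self]
    · rw [ha i hit, hc i hit, mul_zero, sub_zero]
  have hax' : ∑ i, a' i • v i = x := by
    simp only [a', add_smul, sub_smul, mul_smul, Finset.sum_add_distrib, Finset.sum_sub_distrib,
      ← Finset.smul_sum, hcv, hax]
    rw [Finset.sum_eq_single j]
    · simp
    · intro i _ hi
      simp [Pi.single_eq_of_ne hi]
    · simp
  refine ⟨u, fun i => ?_, ?_⟩
  · rw [repr_indexBasis_of_sum u ha' hax']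
    have : 0 ≤ Pi.single (M := fun _ => ℝ) j τ i := by
      by_cases hij : (i : ι) = j
      · rw [hij, Pi.single_eq_same]; exact hτ0
      · rw [Pi.single_eq_of_ne hij]
    exact add_nonneg (hnn i) this
  · rw [price_of_sum ω u ha' hax', price_of_sum ω t ha hax]
    rw [price_of_sum ω t hc hcv] at hlt
    have h1 : ∑ i, a' i * ω i = ∑ i, a i * ω i - τ * ∑ i, c i * ω i + τ * ω j := by
      simp only [a', add_mul, sub_mul, mul_assoc, Finset.sum_add_distrib, Finset.sum_sub_distrib,
        ← Finset.mul_sum]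
      congr 1
      rw [Finset.sum_eq_single j]
      · simp
      · intro i _ hi
        simp [Pi.single_eq_of_ne hi]
      · simp
    rw [h1]
    nlinarith

/-- A vector is generic if it has no vanishing coordinate in any of the bases. -/
def IsGeneric (v : ι → V) (x : V) : Prop :=
  ∀ (t : BasisIndex v) (i : t.1), (indexBasis t).repr x i ≠ 0

/-- A generic point of the cone lies in exactly one simplicial cone of a regular triangulation. -/
theorem existsUnique_isRegularBasis (hv : ⊤ ≤ Submodule.span ℝ (Set.range v)) {h : V →ₗ[ℝ] ℝ}
    (hh : ∀ i, h (v i) = 1) {ω : ι → ℝ} (hω : IsGenericPrice v ω) {x : V} (hx : x ∈ coneOf v)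
    (hgen : IsGeneric v x) :
    ∃! t : BasisIndex v, IsRegularBasis ω t ∧ ∀ i, 0 ≤ (indexBasis t).repr x i := by
  classical
  obtain ⟨t₀, ht₀⟩ := exists_repr_nonneg hv hx
  obtain ⟨t, ht, hmin⟩ := Finset.exists_min_image
    (Finset.univ.filter fun t : BasisIndex v => ∀ i, 0 ≤ (indexBasis t).repr x i)
    (fun t => price ω t x) ⟨t₀, by simpa using ht₀⟩
  have ht' : ∀ i, 0 ≤ (indexBasis t).repr x i := (Finset.mem_filter.mp ht).2
  have hpos : ∀ u : BasisIndex v, (∀ i, 0 ≤ (indexBasis u).repr x i) →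
      ∀ i, 0 < (indexBasis u).repr x i := fun u hu i => (hu i).lt_of_ne (hgen u i).symm
  have hreg : IsRegularBasis ω t := by
    intro j hj
    refine lt_of_le_of_ne (not_lt.mp fun hlt => ?_) (hω t j hj)
    obtain ⟨u, hu, hlt'⟩ := exists_price_lt hh (hpos t ht') hj hlt
    exact absurd (hmin u (Finset.mem_filter.mpr ⟨Finset.mem_univ _, hu⟩)) (not_le.mpr hlt')
  refine ⟨t, ⟨hreg, ht'⟩, fun u ⟨hu, hu'⟩ => Subtype.ext (Finset.Subset.antisymm ?_ ?_)⟩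
  · exact hreg.subset hu ht' (hpos u hu')
  · exact hu.subset hreg hu' (hpos t ht')

end Triangulation

section Reciprocity

open Filter Topology

variable {V ι : Type*} [AddCommGroup V] [Module ℝ V] [Fintype ι] {v : ι → V}

lemma zero_mem_coneOf : (0 : V) ∈ coneOf v := ⟨0, by simp⟩

lemma add_mem_coneOf {x y : V} (hx : x ∈ coneOf v) (hy : y ∈ coneOf v) : x + y ∈ coneOf v := by
  obtain ⟨a, ha, rfl⟩ := hx
  obtain ⟨c, hc, rfl⟩ := hy
  exact ⟨fun i => a i + c i, fun i => add_nonneg (ha i) (hc i), by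
    simp [add_smul, Finset.sum_add_distrib]⟩

lemma smul_mem_coneOf {x : V} (hx : x ∈ coneOf v) {r : ℝ} (hr : 0 ≤ r) : r • x ∈ coneOf v := by
  obtain ⟨a, ha, rfl⟩ := hx
  exact ⟨fun i => r * a i, fun i => mul_nonneg hr (ha i), by simp [mul_smul, Finset.smul_sum]⟩

lemma map_nonneg_of_mem_coneOf {h : V →ₗ[ℝ] ℝ} (hh : ∀ i, h (v i) = 1) {x : V}
    (hx : x ∈ coneOf v) : 0 ≤ h x := by
  obtain ⟨a, ha, rfl⟩ := hx
  simpa [hh] using Finset.sum_nonneg fun i _ => ha i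

lemma eq_zero_of_mem_coneOf {h : V →ₗ[ℝ] ℝ} (hh : ∀ i, h (v i) = 1) {x : V}
    (hx : x ∈ coneOf v) (hx0 : h x = 0) : x = 0 := by
  obtain ⟨a, ha, rfl⟩ := hx
  have h0 : ∑ i, a i = 0 := by simpa [hh] using hx0
  rw [Finset.sum_eq_zero_iff_of_nonneg fun i _ => ha i] at h0
  exact Finset.sum_eq_zero fun i hi => by rw [h0 i hi, zero_smul]

/-- The points that enter the cone when they are moved slightly in the direction `d`. -/
def perturbedCone (v : ι → V) (d : V) : Set V :=
  {x | ∀ᶠ ε in 𝓝[>] (0 : ℝ), x + ε • d ∈ coneOf v}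

lemma mem_perturbedCone {d x : V} :
    x ∈ perturbedCone v d ↔ ∀ᶠ ε in 𝓝[>] (0 : ℝ), x + ε • d ∈ coneOf v := Iff.rfl

lemma add_mem_perturbedCone {d x y : V} (hx : x ∈ perturbedCone v d) (hy : y ∈ coneOf v) :
    x + y ∈ perturbedCone v d := by
  filter_upwards [mem_perturbedCone.mp hx] with ε hε
  rw [add_right_comm]
  exact add_mem_coneOf hε hy

lemma eventually_sign (y : ℝ) {e : ℝ} (he : e ≠ 0) : ∀ᶠ ε in 𝓝[>] (0 : ℝ),
    (0 ≤ y + ε * e ↔ 0 ≤ y ∧ (e < 0 → 0 < y)) ∧ y + ε * e ≠ 0 := by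
  have htend : Tendsto (fun ε : ℝ => y + ε * e) (𝓝[>] 0) (𝓝 y) := by
    have : Continuous fun ε : ℝ => y + ε * e := by fun_prop
    simpa using (this.tendsto 0).mono_left nhdsWithin_le_nhds
  rcases lt_trichotomy y 0 with hy | rfl | hy
  · filter_upwards [htend.eventually_lt_const hy] with ε hε
    exact ⟨⟨fun h => absurd h (not_le.mpr hε), fun h => absurd h.1 (not_le.mpr hy)⟩, hε.ne⟩
  · filter_upwards [self_mem_nhdsWithin] with ε hε
    have hε' : 0 < ε := hε
    refine ⟨?_, by simp [hε'.ne', he]⟩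
    rcases he.lt_or_gt with h | h
    · have := mul_neg_of_pos_of_neg hε' h
      simp only [zero_add, lt_irrefl, h, true_implies, and_false, iff_false, not_le, this]
    · have := mul_pos hε' h
      simp [this.le, h.le]
  · filter_upwards [htend.eventually_const_lt hy] with ε hε
    exact ⟨⟨fun _ => ⟨hy.le, fun _ => hy⟩, fun _ => hε.le⟩, hε.ne'⟩

lemma eventually_repr_sign {d : V} (hd : IsGeneric v d) (x : V) : ∀ᶠ ε in 𝓝[>] (0 : ℝ),
    IsGeneric v (x + ε • d) ∧ ∀ t : BasisIndex v, (∀ i, 0 ≤ (indexBasis t).repr (x + ε • d) i) ↔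
      x ∈ halfOpenCone (indexBasis t) fun i => (indexBasis t).repr d i < 0 := by
  have h : ∀ᶠ ε in 𝓝[>] (0 : ℝ), ∀ (t : BasisIndex v) (i : t.1),
      (0 ≤ (indexBasis t).repr x i + ε * (indexBasis t).repr d i ↔ 0 ≤ (indexBasis t).repr x i ∧
        ((indexBasis t).repr d i < 0 → 0 < (indexBasis t).repr x i)) ∧
      (indexBasis t).repr x i + ε * (indexBasis t).repr d i ≠ 0 := by
    simp only [eventually_all]
    exact fun t i => eventually_sign _ (hd t i)
  filter_upwards [h] with ε hε
  refine ⟨fun t i => ?_, fun t => forall_congr' fun i => ?_⟩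
  · simpa using (hε t i).2
  · simpa using (hε t i).1

section

variable (hv : ⊤ ≤ Submodule.span ℝ (Set.range v)) {h : V →ₗ[ℝ] ℝ} (hh : ∀ i, h (v i) = 1)
  {ω : ι → ℝ} (hω : IsGenericPrice v ω) {d : V} (hd : IsGeneric v d)

include hd in
lemma halfOpenCone_subset_perturbedCone (t : BasisIndex v) :
    (halfOpenCone (indexBasis t) fun i => (indexBasis t).repr d i < 0) ⊆ perturbedCone v d := by
  intro x hx
  filter_upwards [eventually_repr_sign hd x] with ε hε
  exact mem_coneOf_of_repr_nonneg t ((hε.2 t).mpr hx)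

include hv hh hω hd in
/-- A regular triangulation partitions the perturbed cone into half-open simplicial cones. -/
theorem existsUnique_mem_halfOpenCone {x : V} (hx : x ∈ perturbedCone v d) :
    ∃! t : BasisIndex v, IsRegularBasis ω t ∧
      x ∈ halfOpenCone (indexBasis t) fun i => (indexBasis t).repr d i < 0 := by
  obtain ⟨ε, hε, hgen, hiff⟩ := ((mem_perturbedCone.mp hx).and (eventually_repr_sign hd x)).exists
  simp only [← hiff]
  exact existsUnique_isRegularBasis hv hh hω hε hgen

include hv hh hd in
lemma perturbedCone_subset_coneOf : perturbedCone v d ⊆ coneOf v := by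
  obtain ⟨ω, hω⟩ := exists_isGenericPrice v
  intro x hx
  obtain ⟨t, ⟨-, ht⟩, -⟩ := existsUnique_mem_halfOpenCone hv hh hω hd hx
  exact mem_coneOf_of_repr_nonneg t fun i => (ht i).1

include hv hh hd in
lemma perturbedCone_eq_coneOf (hdv : d ∈ coneOf v) : perturbedCone v d = coneOf v := by
  refine (perturbedCone_subset_coneOf hv hh hd).antisymm fun x hx => ?_
  filter_upwards [self_mem_nhdsWithin] with ε hε
  exact add_mem_coneOf hx (smul_mem_coneOf hdv (le_of_lt hε))

open Classical in
/-- The `h*`-vector of the triangulation given by `ω`, computed by perturbing in the direction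
`d`. -/
def hStar (Λ : AddSubgroup V) (h : V →ₗ[ℝ] ℝ) (v : ι → V) (ω : ι → ℝ) (d : V) (j : ℕ) : ℕ :=
  ∑ t : {t : BasisIndex v // IsRegularBasis ω t},
    latticeCount Λ h (halfOpenBox (indexBasis t.1) fun i => (indexBasis t.1).repr d i < 0) j

variable {Λ : AddSubgroup V} (hvΛ : ∀ i, v i ∈ Λ)

include hvΛ hh hd in
/-- Reversing the perturbation reverses the `h*`-vector. -/
theorem hStar_neg {j j' : ℕ} (hj : j + j' = Module.finrank ℝ V) :
    hStar Λ h v ω (-d) j = hStar Λ h v ω d j' := by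
  classical
  refine Finset.sum_congr rfl fun t _ => ?_
  rw [latticeCount_halfOpenBox_compl (j' := j') (by simp [hvΛ]) (by simp [hh])
    (by rw [Fintype.card_coe, t.1.2.1, hj])]
  congr 2
  funext i
  have := hd t.1 i
  simp only [map_neg, Finsupp.coe_neg, Pi.neg_apply, Left.neg_neg_iff, not_lt, eq_iff_iff]
  exact ⟨fun h => h.lt_of_ne this, fun h => h.le⟩

include hv hh hω hd hvΛ in
/-- The Ehrhart function of the perturbed cone in terms of the `h*`-vector. -/
theorem latticeCount_perturbedCone (hΛ : ∀ x ∈ Λ, ∃ z : ℤ, h x = z)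
    (hfin : ∀ k : ℕ, {x : V | x ∈ Λ ∧ x ∈ coneOf v ∧ h x = k}.Finite) (k : ℕ) :
    latticeCount Λ h (perturbedCone v d) k =
      ∑ j ∈ Finset.range (Module.finrank ℝ V + 1),
        hStar Λ h v ω d j * compCount (Module.finrank ℝ V) j k := by
  classical
  let f : (Σ t : {t : BasisIndex v // IsRegularBasis ω t}, {x : V // x ∈ Λ ∧
      (x ∈ halfOpenCone (indexBasis t.1) fun i => (indexBasis t.1).repr d i < 0) ∧ h x = k}) →
      {x : V // x ∈ Λ ∧ x ∈ perturbedCone v d ∧ h x = k} := fun p =>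
    ⟨p.2.1, p.2.2.1, halfOpenCone_subset_perturbedCone hd p.1.1 p.2.2.2.1, p.2.2.2.2⟩
  have hf : Function.Bijective f := by
    constructor
    · rintro ⟨⟨t, ht⟩, ⟨x, hxΛ, hx, hxk⟩⟩ ⟨⟨t', ht'⟩, ⟨x', hxΛ', hx', hxk'⟩⟩ hEq
      have hxx : x = x' := congrArg Subtype.val hEq
      subst hxx
      have htt : t = t' := (existsUnique_mem_halfOpenCone hv hh hω hd
        (halfOpenCone_subset_perturbedCone hd t hx)).unique ⟨ht, hx⟩ ⟨ht', hx'⟩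
      subst htt
      rfl
    · rintro ⟨x, hxΛ, hx, hxk⟩
      obtain ⟨t, ⟨ht, hxt⟩, -⟩ := existsUnique_mem_halfOpenCone hv hh hω hd hx
      exact ⟨⟨⟨t, ht⟩, ⟨x, hxΛ, hxt, hxk⟩⟩, rfl⟩
  have hfin' : ∀ (t : BasisIndex v) (k : ℕ),
      {x : V | x ∈ Λ ∧ (∀ i, 0 ≤ (indexBasis t).repr x i) ∧ h x = k}.Finite := fun t k =>
    (hfin k).subset fun x hx => ⟨hx.1, mem_coneOf_of_repr_nonneg t hx.2.1, hx.2.2⟩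
  have hfinite : ∀ t : {t : BasisIndex v // IsRegularBasis ω t}, Finite {x : V // x ∈ Λ ∧
      (x ∈ halfOpenCone (indexBasis t.1) fun i => (indexBasis t.1).repr d i < 0) ∧ h x = k} :=
    fun t => (hfin' t.1 k).subset fun x hx => ⟨hx.1, fun i => (hx.2.1 i).1, hx.2.2⟩
  rw [latticeCount, ← Nat.card_congr (Equiv.ofBijective f hf), Nat.card_sigma]
  simp only [hStar, Finset.sum_mul]
  rw [Finset.sum_comm]
  refine Finset.sum_congr rfl fun t _ => ?_
  have h1 := latticeCount_halfOpenCone (b := indexBasis t.1)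
    (s := fun i => (indexBasis t.1).repr d i < 0) (by simp [hvΛ]) (by simp [hh]) hΛ
    (hfin' t.1) k
  rw [Fintype.card_coe, t.1.2.1] at h1
  rw [Finset.sum_range]
  exact h1

end

/-- If the interior lattice point of smallest height is unique and has height `finrank V - 2`, then
every interior lattice point lies in its translate of the cone. -/
theorem sub_mem_coneOf_of_unique (hv : ⊤ ≤ Submodule.span ℝ (Set.range v)) {h : V →ₗ[ℝ] ℝ}
    (hh : ∀ i, h (v i) = 1) {q : V} (hq : IsGeneric v q) (hqv : q ∈ coneOf v)
    {Λ : AddSubgroup V} (hvΛ : ∀ i, v i ∈ Λ) (hΛ : ∀ x ∈ Λ, ∃ z : ℤ, h x = z)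
    (hfin : ∀ k : ℕ, {x : V | x ∈ Λ ∧ x ∈ coneOf v ∧ h x = k}.Finite)
    {c : ℕ} (hc : c + 2 = Module.finrank ℝ V) {m : V} (hmΛ : m ∈ Λ)
    (hm : m ∈ perturbedCone v (-q)) (hmc : h m = c)
    (huniq : ∀ x ∈ Λ, x ∈ perturbedCone v (-q) → h x = c → x = m)
    (hlow : ∀ x ∈ Λ, x ∈ perturbedCone v (-q) → ∀ k : ℕ, k < c → h x ≠ k)
    {x : V} (hxΛ : x ∈ Λ) (hx : x ∈ perturbedCone v (-q)) : x - m ∈ coneOf v := by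
  obtain ⟨ω, hω⟩ := exists_isGenericPrice v
  have hq' : IsGeneric v (-q) := fun t i => by simpa using hq t i
  have hsub := perturbedCone_subset_coneOf hv hh hq'
  have hL := latticeCount_perturbedCone hv hh hω hq hvΛ hΛ hfin
  have hI := latticeCount_perturbedCone hv hh hω hq' hvΛ hΛ hfin
  rw [perturbedCone_eq_coneOf hv hh hq hqv] at hL
  simp only [← hc] at hL hI
  have hneg : ∀ j j', j + j' = c + 2 → hStar Λ h v ω (-q) j = hStar Λ h v ω q j' :=
    fun j j' hj => hStar_neg hh hq hvΛ (hj.trans hc)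
  have hH0 : hStar Λ h v ω q 0 = 1 := by
    have h1 : latticeCount Λ h (coneOf v) 0 = 1 := by
      rw [latticeCount, Nat.card_eq_one_iff_unique]
      refine ⟨⟨fun y z => Subtype.ext ?_⟩, ⟨⟨0, Λ.zero_mem, zero_mem_coneOf, by simp⟩⟩⟩
      rw [eq_zero_of_mem_coneOf hh y.2.2.1 (by simpa using y.2.2.2),
        eq_zero_of_mem_coneOf hh z.2.2.1 (by simpa using z.2.2.2)]
    rw [hL, Finset.sum_eq_single 0] at h1
    · rwa [compCount_self, mul_one] at h1
    · intro j _ hj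
      rw [compCount_of_lt (Nat.pos_of_ne_zero hj), mul_zero]
    · simp
  have hHlow : ∀ j < c, hStar Λ h v ω (-q) j = 0 := by
    intro j hj
    have h1 : latticeCount Λ h (perturbedCone v (-q)) j = 0 := by
      have : IsEmpty {x : V // x ∈ Λ ∧ x ∈ perturbedCone v (-q) ∧ h x = j} :=
        ⟨fun y => hlow y.1 y.2.1 y.2.2.1 j hj y.2.2.2⟩
      exact Nat.card_of_isEmpty
    rw [hI, Finset.sum_eq_zero_iff] at h1
    have := h1 j (Finset.mem_range.mpr (by omega))
    rwa [compCount_self, mul_one] at this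
  have hHc : hStar Λ h v ω (-q) c = 1 := by
    have h1 : latticeCount Λ h (perturbedCone v (-q)) c = 1 := by
      rw [latticeCount, Nat.card_eq_one_iff_unique]
      refine ⟨⟨fun y z => Subtype.ext ?_⟩, ⟨⟨m, hmΛ, hm, hmc⟩⟩⟩
      rw [huniq y.1 y.2.1 y.2.2.1 y.2.2.2, huniq z.1 z.2.1 z.2.2.1 z.2.2.2]
    rw [hI, Finset.sum_eq_single c] at h1
    · rwa [compCount_self, mul_one] at h1
    · intro j _ hj
      rcases hj.lt_or_gt with hj | hj
      · rw [hHlow j hj, zero_mul]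
      · rw [compCount_of_lt hj, mul_zero]
    · exact fun hn => absurd (Finset.mem_range.mpr (by omega)) hn
  have hcount : ∀ k, latticeCount Λ h (perturbedCone v (-q)) (k + c) =
      latticeCount Λ h (coneOf v) k := by
    intro k
    rw [hI, hL, show c + 2 + 1 = c + 3 by ring, Finset.sum_range_add, add_comm c 3,
      Finset.sum_range_add, Finset.sum_eq_zero (s := Finset.range c), zero_add,
      Finset.sum_eq_zero (s := Finset.range c), add_zero]
    · simp only [compCount_add_add]
      simp only [Finset.sum_range_succ, Finset.sum_range_zero, zero_add, add_zero]
      rw [hneg (c + 2) 0 (by omega), hneg (c + 1) 1 (by omega), ← hneg c 2 (by omega), hHc, hH0]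
    · intro j hj
      have hj' := Finset.mem_range.mp hj
      rw [← hneg (c - 1 - j) (3 + j) (by omega), hHlow _ (by omega), zero_mul]
    · intro j hj
      rw [hHlow j (Finset.mem_range.mp hj), zero_mul]
  obtain ⟨z, hz⟩ := hΛ x hxΛ
  have hz0 : 0 ≤ z := by
    have := map_nonneg_of_mem_coneOf hh (hsub hx)
    rw [hz] at this
    exact_mod_cast this
  obtain ⟨k', rfl⟩ := Int.eq_ofNat_of_zero_le hz0
  have hk' : c ≤ k' := not_lt.mp fun hlt => hlow x hxΛ hx k' hlt (by simpa using hz)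
  obtain ⟨k, rfl⟩ := Nat.exists_eq_add_of_le' hk'
  let f : {y : V // y ∈ Λ ∧ y ∈ coneOf v ∧ h y = k} →
      {y : V // y ∈ Λ ∧ y ∈ perturbedCone v (-q) ∧ h y = (k + c : ℕ)} := fun y =>
    ⟨m + y.1, Λ.add_mem hmΛ y.2.1, add_mem_perturbedCone hm y.2.2.1, by
      rw [map_add, hmc, y.2.2.2]; push_cast; ring⟩
  have hfi : Function.Injective f := fun y z hyz =>
    Subtype.ext (add_left_cancel (congrArg Subtype.val hyz))
  have : Finite {y : V // y ∈ Λ ∧ y ∈ perturbedCone v (-q) ∧ h y = (k + c : ℕ)} :=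
    (hfin (k + c)).subset fun y hy => ⟨hy.1, hsub hy.2.1, hy.2.2⟩
  obtain ⟨y, hy⟩ := (hfi.bijective_of_nat_card_le (hcount k).le).2
    ⟨x, hxΛ, hx, by simpa using hz⟩
  have hyx : m + y.1 = x := congrArg Subtype.val hy
  rw [← hyx, add_sub_cancel_left]
  exact y.2.2.1

end Reciprocity

section LatticePolytope

open Filter Topology

variable {n : ℕ}

/-- The lattice points of `ℝⁿ` form a subgroup. -/
def latSubgroup (n : ℕ) : AddSubgroup (Fin n → ℝ) where
  carrier := lat n
  zero_mem' := fun i => ⟨0, by simp⟩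
  add_mem' := fun {x y} hx hy i => by
    obtain ⟨a, ha⟩ := hx i
    obtain ⟨c, hc⟩ := hy i
    exact ⟨a + c, by simp [ha, hc]⟩
  neg_mem' := fun {x} hx i => by
    obtain ⟨a, ha⟩ := hx i
    exact ⟨-a, by simp [ha]⟩

/-- The lattice `ℤⁿ × ℤ` containing the cone over a lattice polytope. -/
def heightLattice (n : ℕ) : AddSubgroup ((Fin n → ℝ) × ℝ) :=
  (latSubgroup n).prod (Int.castAddHom ℝ).range

lemma mem_heightLattice {x : (Fin n → ℝ) × ℝ} :
    x ∈ heightLattice n ↔ x.1 ∈ lat n ∧ ∃ z : ℤ, (z : ℝ) = x.2 := by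
  rw [heightLattice, AddSubgroup.mem_prod]
  rfl

/-- The points of `S` placed at height one. -/
def heightOne (S : Finset (Fin n → ℤ)) (s : S) : (Fin n → ℝ) × ℝ :=
  (fun i => (s.1 i : ℝ), 1)

/-- The embedding of `ℝⁿ` as the hyperplane of height one. -/
def heightOneMap (n : ℕ) : (Fin n → ℝ) →ᵃ[ℝ] (Fin n → ℝ) × ℝ :=
  (LinearMap.inl ℝ (Fin n → ℝ) ℝ).toAffineMap + AffineMap.const ℝ _ (0, 1)

lemma heightOneMap_apply (x : Fin n → ℝ) : heightOneMap n x = (x, 1) := by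
  simp [heightOneMap]

lemma eq_top_of_comap_heightOneMap {U : Submodule ℝ ((Fin n → ℝ) × ℝ)}
    (hU : U.toAffineSubspace.comap (heightOneMap n) = ⊤) : U = ⊤ := by
  have h1 : ∀ x : Fin n → ℝ, (x, (1 : ℝ)) ∈ U := fun x => by
    have : x ∈ U.toAffineSubspace.comap (heightOneMap n) := by rw [hU]; trivial
    rw [AffineSubspace.mem_comap, heightOneMap_apply] at this
    exact this
  refine eq_top_iff.mpr fun ⟨x, t⟩ _ => ?_
  have := U.add_mem (U.sub_mem (h1 x) (h1 0)) (U.smul_mem t (h1 0))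
  simpa using this

lemma dilate_eq_smul (k : ℕ) (P : Set (Fin n → ℝ)) : dilate n k P = (k : ℝ) • P := rfl

lemma mem_interior_dilate {k : ℕ} (hk : 0 < k) {P : Set (Fin n → ℝ)} {x : Fin n → ℝ} :
    x ∈ interior (dilate n k P) ↔ ∃ w ∈ interior P, (k : ℝ) • w = x := by
  rw [dilate_eq_smul, interior_smul₀ (by positivity), Set.mem_smul_set]

lemma smul_mem_interior_coneAt {P : Set (Fin n → ℝ)} {v w : Fin n → ℝ} (hw : w ∈ interior P) {r : ℝ} (hr : 0 < r) :
    r • (w - v) ∈ interior (coneAt n P v) := by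
  rw [mem_interior]
  refine ⟨(fun y => r⁻¹ • y + v) ⁻¹' interior P, fun y hy => ?_,
    isOpen_interior.preimage (by fun_prop), ?_⟩
  · refine ⟨r, hr.le, _, interior_subset hy, ?_⟩
    rw [add_sub_cancel_right, smul_smul, mul_inv_cancel₀ hr.ne', one_smul]
  · rw [Set.mem_preimage, smul_smul, inv_mul_cancel₀ hr.ne', one_smul, sub_add_cancel]
    exact hw

section

variable {S : Finset (Fin n → ℤ)} {P : Set (Fin n → ℝ)}
  (hP : P = convexHull ℝ ((fun m : Fin n → ℤ => fun i => (m i : ℝ)) '' (S : Set (Fin n → ℤ))))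

include hP

lemma convex_of_eq_convexHull : Convex ℝ P := hP ▸ convex_convexHull ℝ _

lemma mem_of_mem_vertices (s : S) : (heightOne S s).1 ∈ P :=
  hP ▸ subset_convexHull ℝ _ ⟨s.1, s.2, rfl⟩

lemma mk_one_mem_coneOf {p : Fin n → ℝ} (hp : p ∈ P) : (p, (1 : ℝ)) ∈ coneOf (heightOne S) := by
  classical
  have hconv : Convex ℝ {p : Fin n → ℝ | (p, (1 : ℝ)) ∈ coneOf (heightOne S)} := by
    intro x hx y hy a c ha hc hac
    have := add_mem_coneOf (smul_mem_coneOf hx ha) (smul_mem_coneOf hy hc)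
    simpa [hac] using this
  rw [hP] at hp
  refine convexHull_min ?_ hconv hp
  rintro _ ⟨s, hs, rfl⟩
  refine ⟨Pi.single ⟨s, hs⟩ 1, fun i => ?_, ?_⟩
  · by_cases hi : i = ⟨s, hs⟩
    · simp [hi]
    · simp [Pi.single_eq_of_ne hi]
  · rw [Finset.sum_eq_single ⟨s, hs⟩]
    · simp [heightOne]
    · intro i _ hi
      simp [Pi.single_eq_of_ne hi]
    · simp

lemma mk_smul_mem_coneOf {p : Fin n → ℝ} (hp : p ∈ P) {t : ℝ} (ht : 0 ≤ t) :
    (t • p, t) ∈ coneOf (heightOne S) := by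
  simpa using smul_mem_coneOf (mk_one_mem_coneOf hP hp) ht

lemma exists_eq_smul_of_mem_coneOf (hne : P.Nonempty) {x : Fin n → ℝ} {t : ℝ}
    (hx : (x, t) ∈ coneOf (heightOne S)) : 0 ≤ t ∧ ∃ p ∈ P, x = t • p := by
  obtain ⟨a, ha, hax⟩ := hx
  have hsum : ∑ i, a i = t := by
    have := congrArg Prod.snd hax
    simpa [Prod.snd_sum, heightOne] using this
  have hx1 : ∑ i, a i • (heightOne S i).1 = x := by
    have := congrArg Prod.fst hax
    simpa [Prod.fst_sum] using this
  have ht : 0 ≤ t := hsum ▸ Finset.sum_nonneg fun i _ => ha i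
  refine ⟨ht, ?_⟩
  rcases ht.eq_or_lt with h0 | hpos
  · obtain ⟨p, hp⟩ := hne
    refine ⟨p, hp, ?_⟩
    rw [← h0, Finset.sum_eq_zero_iff_of_nonneg fun i _ => ha i] at hsum
    rw [← h0, zero_smul, ← hx1]
    exact Finset.sum_eq_zero fun i hi => by rw [hsum i hi, zero_smul]
  · refine ⟨∑ i, (a i / t) • (heightOne S i).1, ?_, ?_⟩
    · refine (convex_of_eq_convexHull hP).sum_mem (fun i _ => div_nonneg (ha i) ht) ?_
        fun i _ => mem_of_mem_vertices hP i
      rw [← Finset.sum_div, hsum, div_self hpos.ne']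
    · rw [Finset.smul_sum, ← hx1]
      refine Finset.sum_congr rfl fun i _ => ?_
      rw [smul_smul, mul_div_cancel₀ _ hpos.ne']

lemma top_le_span_heightOne (htop : affineSpan ℝ P = ⊤) :
    ⊤ ≤ Submodule.span ℝ (Set.range (heightOne S)) := by
  refine (eq_top_of_comap_heightOneMap (top_le_iff.mp ?_)).ge
  rw [← htop, affineSpan_le]
  intro p hp
  rw [SetLike.mem_coe, AffineSubspace.mem_comap, heightOneMap_apply]
  obtain ⟨a, -, ha⟩ := mk_one_mem_coneOf hP hp
  rw [← ha]
  exact Submodule.sum_mem _ fun i _ =>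
    Submodule.smul_mem _ _ (Submodule.subset_span ⟨i, rfl⟩)

lemma finite_heightLattice_inter_coneOf (hne : P.Nonempty) (k : ℕ) :
    {x : (Fin n → ℝ) × ℝ | x ∈ heightLattice n ∧ x ∈ coneOf (heightOne S) ∧
      LinearMap.snd ℝ (Fin n → ℝ) ℝ x = k}.Finite := by
  have hbdd : Bornology.IsBounded P := by
    rw [hP]
    exact ((S.finite_toSet.image _).isCompact_convexHull ℝ).isBounded
  obtain ⟨R, hR⟩ := hbdd.exists_norm_le
  obtain ⟨B, hB⟩ := exists_nat_ge (k * R)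
  refine ((Set.finite_Icc (fun _ : Fin n => -(B : ℤ)) (fun _ => (B : ℤ))).image
    fun z => ((fun i => (z i : ℝ)), (k : ℝ))).subset ?_
  rintro ⟨x, t⟩ ⟨hxΛ, hx, ht⟩
  have ht' : t = k := ht
  subst ht'
  obtain ⟨-, p, hp, rfl⟩ := exists_eq_smul_of_mem_coneOf hP hne hx
  choose z hz using (mem_heightLattice.mp hxΛ).1
  have hbound : ∀ i, |(z i : ℝ)| ≤ B := fun i => by
    rw [← hz]
    simp only [Pi.smul_apply, smul_eq_mul, abs_mul, Nat.abs_cast]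
    refine le_trans (mul_le_mul_of_nonneg_left ?_ (Nat.cast_nonneg k)) hB
    exact (norm_le_pi_norm p i).trans (hR p hp)
  refine ⟨z, ⟨fun i => ?_, fun i => ?_⟩, ?_⟩
  · exact_mod_cast (abs_le.mp (hbound i)).1
  · exact_mod_cast (abs_le.mp (hbound i)).2
  · simp only [Prod.mk.injEq, and_true]
    funext i
    exact (hz i).symm

lemma mem_interior_dilate_iff {q : Fin n → ℝ} (hq : q ∈ interior P) {k : ℕ} (hk : 0 < k)
    {x : Fin n → ℝ} :
    x ∈ interior (dilate n k P) ↔ (x, (k : ℝ)) ∈ perturbedCone (heightOne S) (-(q, 1)) := by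
  have hkR : (0 : ℝ) < k := by exact_mod_cast hk
  have hsmall : ∀ᶠ ε : ℝ in 𝓝[>] 0, ε < (k : ℝ) :=
    mem_nhdsWithin_of_mem_nhds (Iio_mem_nhds hkR)
  have hform : ∀ ε : ℝ, (x, (k : ℝ)) + ε • (-(q, (1 : ℝ))) = (x - ε • q, k - ε) := fun ε => by
    simp [sub_eq_add_neg]
  rw [mem_interior_dilate hk, mem_perturbedCone]
  simp only [hform]
  constructor
  · rintro ⟨w, hw, rfl⟩
    have htend : Tendsto (fun ε : ℝ => ((k : ℝ) - ε)⁻¹ • ((k : ℝ) • w - ε • q)) (𝓝[>] 0)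
        (𝓝 w) := by
      have h1 : ContinuousAt (fun ε : ℝ => ((k : ℝ) - ε)⁻¹ • ((k : ℝ) • w - ε • q)) 0 := by
        have h0 : ContinuousAt (fun ε : ℝ => (k : ℝ) - ε) 0 := by fun_prop
        exact (h0.inv₀ (by rw [sub_zero]; exact hkR.ne')).smul (by fun_prop)
      have h2 := h1.tendsto
      simp only [sub_zero, zero_smul, smul_smul, inv_mul_cancel₀ hkR.ne', one_smul] at h2
      exact h2.mono_left nhdsWithin_le_nhds
    filter_upwards [hsmall, htend (mem_interior_iff_mem_nhds.mp hw)] with ε hε hmem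
    have hpos : 0 < (k : ℝ) - ε := sub_pos.mpr hε
    have := mk_smul_mem_coneOf hP hmem hpos.le
    rwa [smul_smul, mul_inv_cancel₀ hpos.ne', one_smul] at this
  · intro hev
    obtain ⟨ε, ⟨hmem, hε⟩, hε0⟩ := ((hev.and hsmall).and self_mem_nhdsWithin).exists
    have hε0' : 0 < ε := hε0
    obtain ⟨-, p, hp, hxp⟩ := exists_eq_smul_of_mem_coneOf hP ⟨q, interior_subset hq⟩ hmem
    refine ⟨(((k : ℝ) - ε) / k) • p + (ε / k) • q,
      (convex_of_eq_convexHull hP).combo_self_interior_mem_interior hp hq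
        (div_nonneg (sub_pos.mpr hε).le hkR.le) (div_pos hε0' hkR) (by field_simp; ring), ?_⟩
    rw [smul_add, smul_smul, smul_smul, mul_div_cancel₀ _ hkR.ne', mul_div_cancel₀ _ hkR.ne',
      ← hxp]
    simp

lemma exists_isGeneric (htop : affineSpan ℝ P = ⊤) :
    ∃ q ∈ interior P, IsGeneric (heightOne S) (q, 1) := by
  classical
  have hne : (interior P).Nonempty := by
    rw [(convex_of_eq_convexHull hP).interior_nonempty_iff_affineSpan_eq_top]
    exact htop
  let E : (Σ t : BasisIndex (heightOne S), t.1) → AffineSubspace ℝ (Fin n → ℝ) := fun p =>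
    (LinearMap.ker ((indexBasis p.1).coord p.2)).toAffineSubspace.comap (heightOneMap n)
  have hE : ∀ p, E p ≠ ⊤ := by
    rintro ⟨t, i⟩ h
    have h1 := eq_top_of_comap_heightOneMap h
    have h2 : indexBasis t i ∈ LinearMap.ker ((indexBasis t).coord i) := by
      rw [h1]
      trivial
    rw [LinearMap.mem_ker, Module.Basis.coord_apply, Module.Basis.repr_self,
      Finsupp.single_eq_same] at h2
    exact one_ne_zero h2
  have hnull : MeasureTheory.volume (⋃ p, (E p : Set (Fin n → ℝ))) = 0 :=
    MeasureTheory.measure_iUnion_null fun p => MeasureTheory.Measure.addHaar_affineSubspace _ _ (hE p)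
  have hpos := isOpen_interior.measure_pos MeasureTheory.volume hne
  obtain ⟨q, hq, hqE⟩ := Set.not_subset.mp fun hsub =>
    hpos.ne' (MeasureTheory.measure_mono_null hsub hnull)
  refine ⟨q, hq, fun t i h0 => hqE (Set.mem_iUnion.mpr ⟨⟨t, i⟩, ?_⟩)⟩
  rw [SetLike.mem_coe, AffineSubspace.mem_comap, heightOneMap_apply]
  exact h0

lemma exists_mem_interior_dilate {v q : Fin n → ℝ} (hv : v ∈ P) (hq : q ∈ interior P)
    {x : Fin n → ℝ} (hx : x ∈ interior (coneAt n P v)) :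
    ∃ k : ℕ, 0 < k ∧ x + (k : ℝ) • v ∈ interior (dilate n k P) := by
  have hconv := convex_of_eq_convexHull hP
  have htend : Tendsto (fun δ : ℝ => x - δ • (q - v)) (𝓝[>] 0) (𝓝 x) := by
    have h1 : Continuous fun δ : ℝ => x - δ • (q - v) := by fun_prop
    simpa using (h1.tendsto 0).mono_left nhdsWithin_le_nhds
  have hev : ∀ᶠ δ : ℝ in 𝓝[>] 0, x - δ • (q - v) ∈ coneAt n P v :=
    htend (mem_interior_iff_mem_nhds.mp hx)
  obtain ⟨δ, ⟨r, hr, p, hp, hxp⟩, hδ⟩ := (hev.and self_mem_nhdsWithin).exists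
  have hδ0 : 0 < δ := hδ
  obtain ⟨k, hk⟩ := exists_nat_gt (r + δ)
  have hk0 : (0 : ℝ) < k := by linarith
  have hpv : (r / (k - δ)) • p + ((k - δ - r) / (k - δ)) • v ∈ P :=
    hconv hp hv (div_nonneg hr (by linarith)) (div_nonneg (by linarith) (by linarith))
      (by rw [← add_div, div_eq_one_iff_eq (by linarith)]; ring)
  refine ⟨k, by exact_mod_cast hk0, (mem_interior_dilate (by exact_mod_cast hk0)).mpr
    ⟨_, hconv.combo_self_interior_mem_interior hpv hq (a := (k - δ) / k) (b := δ / k)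
      (div_nonneg (by linarith) hk0.le) (div_pos hδ0 hk0) (by field_simp; ring), ?_⟩⟩
  have hkδ : (k : ℝ) - δ ≠ 0 := by linarith
  rw [sub_eq_iff_eq_add.mp hxp, smul_add, smul_smul, smul_smul, mul_div_cancel₀ _ hk0.ne',
    mul_div_cancel₀ _ hk0.ne', smul_add, smul_smul, smul_smul, mul_div_cancel₀ _ hkδ,
    mul_div_cancel₀ _ hkδ]
  module

/-- An interior lattice point `m` of `(n-1)P` such that every interior lattice point of the cone
over `P` lies in the translate of the cone by `m` exhibits `P` as Gorenstein at every vertex. -/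
lemma gorensteinAt_of_forall_sub_mem {c : ℕ} (hc : 0 < c) {q m v : Fin n → ℝ}
    (hq : q ∈ interior P) (hm : m ∈ interior (dilate n c P)) (hmΛ : m ∈ lat n) (hv : v ∈ P)
    (hvΛ : v ∈ lat n)
    (hsub : ∀ x ∈ lat n, ∀ k : ℕ, 0 < k → x ∈ interior (dilate n k P) →
      (x - m, (k : ℝ) - c) ∈ coneOf (heightOne S)) :
    GorensteinAt n P v := by
  have hconv := convex_of_eq_convexHull hP
  have hcR : (0 : ℝ) < c := by exact_mod_cast hc
  obtain ⟨w, hw, rfl⟩ := (mem_interior_dilate hc).mp hm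
  have hsmulΛ : ∀ k : ℕ, (k : ℝ) • v ∈ lat n := fun k => by
    have : k • v ∈ latSubgroup n := (latSubgroup n).nsmul_mem hvΛ k
    rwa [← Nat.cast_smul_eq_nsmul ℝ] at this
  have hmvΛ : (c : ℝ) • (w - v) ∈ lat n := by
    rw [smul_sub]
    exact (latSubgroup n).sub_mem hmΛ (hsmulΛ c)
  refine ⟨(c : ℝ) • (w - v), ⟨⟨c, hcR.le, w, interior_subset hw, rfl⟩, hmvΛ⟩, ?_⟩
  refine Set.Subset.antisymm ?_ ?_
  · rintro x ⟨hx, hxΛ⟩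
    refine ⟨x - (c : ℝ) • (w - v), ⟨?_, (latSubgroup n).sub_mem hxΛ hmvΛ⟩,
      add_sub_cancel _ _⟩
    obtain ⟨k, hk, hxk⟩ := exists_mem_interior_dilate hP hv hq hx
    obtain ⟨ht, p, hp, hxp⟩ := exists_eq_smul_of_mem_coneOf hP ⟨v, hv⟩
      (hsub _ ((latSubgroup n).add_mem hxΛ (hsmulΛ k)) k hk hxk)
    refine ⟨_, ht, p, hp, ?_⟩
    rw [smul_sub _ p v, ← hxp]
    module
  · rintro _ ⟨y, ⟨⟨r, hr, x, hx, rfl⟩, hyΛ⟩, rfl⟩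
    refine ⟨?_, (latSubgroup n).add_mem hmvΛ hyΛ⟩
    have hrc : 0 < r + c := by linarith
    have hint := hconv.combo_self_interior_mem_interior hx hw (a := r / (r + c)) (b := c / (r + c))
      (div_nonneg hr hrc.le) (div_pos hcR hrc) (by rw [← add_div, div_self hrc.ne'])
    have := smul_mem_interior_coneAt (v := v) hint hrc
    rw [smul_sub, smul_add, smul_smul, smul_smul, mul_div_cancel₀ _ hrc.ne',
      mul_div_cancel₀ _ hrc.ne'] at this
    convert this using 1
    module

end

end LatticePolytope

/-- For `n ≥ 3`, a lattice `n`-polytope `P` with exactly one lattice point in the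
interior of `(n-1)P` is Gorenstein (lattice-polytope form of: a projective toric `n`-fold
with an ample `L` with `dim Γ(X, L^{⊗(n-1)} ⊗ ω_X) = 1` is Gorenstein toric Del Pezzo). -/
theorem del_pezzo_gorenstein (n : ℕ) (hn : 3 ≤ n) (P : Set (Fin n → ℝ))
    (hP : IsLatticePolytope n P)
    (hint : ∃ m₀, interior (dilate n (n - 1) P) ∩ lat n = {m₀}) :
    Gorenstein n P := by
  obtain ⟨⟨S, -, hPS⟩, htop⟩ := hP
  obtain ⟨m, hm⟩ := hint
  obtain ⟨hmint, hmΛ⟩ : m ∈ interior (dilate n (n - 1) P) ∩ lat n := by rw [hm]; rfl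
  have huniq : ∀ x ∈ interior (dilate n (n - 1) P), x ∈ lat n → x = m := fun x hx hxΛ => by
    have : x ∈ interior (dilate n (n - 1) P) ∩ lat n := ⟨hx, hxΛ⟩
    rwa [hm] at this
  have hn1 : 0 < n - 1 := by omega
  obtain ⟨q, hq, hgen⟩ := exists_isGeneric hPS htop
  have hne : P.Nonempty := ⟨q, interior_subset hq⟩
  have hspan := top_le_span_heightOne hPS htop
  have hh : ∀ s, LinearMap.snd ℝ (Fin n → ℝ) ℝ (heightOne S s) = 1 := fun s => rfl
  have hSΛ : ∀ s, heightOne S s ∈ heightLattice n := fun s =>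
    mem_heightLattice.mpr ⟨fun i => ⟨s.1 i, rfl⟩, 1, by simp [heightOne]⟩
  have hrank : Module.finrank ℝ ((Fin n → ℝ) × ℝ) = n + 1 := by simp
  have hiff := fun {k : ℕ} (hk : 0 < k) {x} => mem_interior_dilate_iff hPS hq hk (x := x)
  have huniq' : ∀ x ∈ heightLattice n, x ∈ perturbedCone (heightOne S) (-(q, 1)) →
      LinearMap.snd ℝ (Fin n → ℝ) ℝ x = (n - 1 : ℕ) → x = (m, ((n - 1 : ℕ) : ℝ)) := by
    rintro ⟨x, t⟩ hxΛ hx ht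
    have ht' : t = (n - 1 : ℕ) := ht
    subst ht'
    rw [huniq x ((hiff hn1).mpr hx) (mem_heightLattice.mp hxΛ).1]
  have hlow : ∀ x ∈ heightLattice n, x ∈ perturbedCone (heightOne S) (-(q, 1)) →
      ∀ k : ℕ, k < n - 1 → LinearMap.snd ℝ (Fin n → ℝ) ℝ x ≠ k := by
    intro x hxΛ hx k hk hxk
    have hcard : 1 < Fintype.card S := by
      have h1 := finrank_range_le_card (R := ℝ) (heightOne S)
      rw [Set.finrank, top_le_iff.mp hspan, finrank_top, hrank] at h1
      omega
    obtain ⟨s, s', hss⟩ := Fintype.exists_pair_of_one_lt_card hcard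
    have key : ∀ s : S, x + (n - 1 - k) • heightOne S s = (m, ((n - 1 : ℕ) : ℝ)) := by
      intro s
      refine huniq' _ (AddSubgroup.add_mem _ hxΛ (AddSubgroup.nsmul_mem _ (hSΛ s) _)) ?_ ?_
      · refine add_mem_perturbedCone hx ?_
        rw [← Nat.cast_smul_eq_nsmul ℝ]
        exact smul_mem_coneOf (mk_one_mem_coneOf hPS (mem_of_mem_vertices hPS s))
          (Nat.cast_nonneg _)
      · rw [map_add, hxk, map_nsmul, hh, nsmul_one, ← Nat.cast_add, Nat.add_sub_cancel' hk.le]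
    have h1 := add_left_cancel ((key s).trans (key s').symm)
    have h2 : heightOne S s = heightOne S s' := nsmul_right_injective (by omega) h1
    refine hss (Subtype.ext (funext fun i => ?_))
    have h3 : (s.1 i : ℝ) = s'.1 i := congrFun (congrArg Prod.fst h2) i
    exact_mod_cast h3
  intro v hv
  have hvS := hv
  rw [hPS] at hvS
  obtain ⟨s, hs, rfl⟩ := extremePoints_convexHull_subset hvS
  refine gorensteinAt_of_forall_sub_mem hPS hn1 hq hmint hmΛ (mem_of_mem_vertices hPS ⟨s, hs⟩)
    (fun i => ⟨s i, rfl⟩) fun x hxΛ k hk hx => ?_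
  exact sub_mem_coneOf_of_unique hspan hh hgen (mk_one_mem_coneOf hPS (interior_subset hq)) hSΛ
    (fun x hx => by
      obtain ⟨z, hz⟩ := (mem_heightLattice.mp hx).2
      exact ⟨z, hz.symm⟩)
    (finite_heightLattice_inter_coneOf hPS hne) (c := n - 1) (by rw [hrank]; omega)
    (m := (m, ((n - 1 : ℕ) : ℝ))) (mem_heightLattice.mpr ⟨hmΛ, (n - 1 : ℕ), by simp⟩)
    ((hiff hn1).mp hmint) rfl huniq' hlow (x := (x, (k : ℝ)))
    (mem_heightLattice.mpr ⟨hxΛ, k, by simp⟩) ((hiff hk).mp hx)
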